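/- Completeness of CL=→: let Γ be a basis; if Γ ⊨ M : σ (viewing the declarations of Γ as LCL-formulas), then Γ ⊢_{CL=} M : σ. -/

import Mathlib

/- ## Syntax of combinatory logic -/

/-- CL-terms: variables, primitive combinators S, K, I, and application. -/
inductive CLTerm : Type
  | var : ℕ → CLTerm
  | S : CLTerm
  | K : CLTerm
  | I : CLTerm
  | app : CLTerm → CLTerm → CLTerm

/-- Simple types: type variables and arrow types. -/
inductive SType : Type
  | var : ℕ → SType
  | arrow : SType → SType → SType

/-- The set of (free) variables occurring in a CL-term. -/
def CLTerm.FV : CLTerm → Set ℕ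
  | .var x => {x}
  | .S => ∅
  | .K => ∅
  | .I => ∅
  | .app M N => M.FV ∪ N.FV

/-- Substitution `M{N/x}` of the term `N` for the variable `x` in `M`. -/
def CLTerm.subst : CLTerm → CLTerm → ℕ → CLTerm
  | .var y, N, x => if y = x then N else .var y
  | .S, _, _ => .S
  | .K, _, _ => .K
  | .I, _, _ => .I
  | .app P Q, N, x => .app (P.subst N x) (Q.subst N x)

/-- A basis is a set of declarations `(x, σ)` with distinct term variables as subjects. -/
def IsBasis (Γ : Set (ℕ × SType)) : Prop :=
  ∀ ⦃x : ℕ⦄ ⦃σ τ : SType⦄, (x, σ) ∈ Γ → (x, τ) ∈ Γ → σ = τ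

/-- The simply typed combinatory logic CL→ : `Γ ⊢_CL M : σ`. -/
inductive CLTyping : Set (ℕ × SType) → CLTerm → SType → Prop
  | var {Γ : Set (ℕ × SType)} {x : ℕ} {σ : SType} : (x, σ) ∈ Γ → CLTyping Γ (.var x) σ
  | S {Γ : Set (ℕ × SType)} (σ ρ τ : SType) :
      CLTyping Γ .S ((σ.arrow (ρ.arrow τ)).arrow ((σ.arrow ρ).arrow (σ.arrow τ)))
  | K {Γ : Set (ℕ × SType)} (σ τ : SType) : CLTyping Γ .K (σ.arrow (τ.arrow σ))
  | I {Γ : Set (ℕ × SType)} (σ : SType) : CLTyping Γ .I (σ.arrow σ)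
  | app {Γ : Set (ℕ × SType)} {M N : CLTerm} {σ τ : SType} : CLTyping Γ M (σ.arrow τ) → CLTyping Γ N σ → CLTyping Γ (M.app N) τ

/-- The extensional equational theory EQ^η of combinatory logic. -/
inductive EqEta : CLTerm → CLTerm → Prop
  | refl (M : CLTerm) : EqEta M M
  | Sred (M N L : CLTerm) : EqEta (((CLTerm.S.app M).app N).app L) ((M.app L).app (N.app L))
  | Kred (M N : CLTerm) : EqEta ((CLTerm.K.app M).app N) M
  | Ired (M : CLTerm) : EqEta (CLTerm.I.app M) M
  | symm {M N : CLTerm} : EqEta M N → EqEta N M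
  | trans {M N L : CLTerm} : EqEta M N → EqEta N L → EqEta M L
  | appL {M N : CLTerm} (P : CLTerm) : EqEta M N → EqEta (M.app P) (N.app P)
  | appR {M N : CLTerm} (P : CLTerm) : EqEta M N → EqEta (P.app M) (P.app N)
  | ext {M N : CLTerm} (x : ℕ) : EqEta (M.app (.var x)) (N.app (.var x)) →
      x ∉ M.FV ∪ N.FV → EqEta M N

/-- The extended type assignment system CL=→ : CL→ plus the rule (eq). -/
inductive CLEqTyping : Set (ℕ × SType) → CLTerm → SType → Prop
  | var {Γ : Set (ℕ × SType)} {x : ℕ} {σ : SType} : (x, σ) ∈ Γ → CLEqTyping Γ (.var x) σ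
  | S {Γ : Set (ℕ × SType)} (σ ρ τ : SType) :
      CLEqTyping Γ .S ((σ.arrow (ρ.arrow τ)).arrow ((σ.arrow ρ).arrow (σ.arrow τ)))
  | K {Γ : Set (ℕ × SType)} (σ τ : SType) : CLEqTyping Γ .K (σ.arrow (τ.arrow σ))
  | I {Γ : Set (ℕ × SType)} (σ : SType) : CLEqTyping Γ .I (σ.arrow σ)
  | app {Γ : Set (ℕ × SType)} {M N : CLTerm} {σ τ : SType} : CLEqTyping Γ M (σ.arrow τ) → CLEqTyping Γ N σ → CLEqTyping Γ (M.app N) τ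
  | eq {Γ : Set (ℕ × SType)} {M N : CLTerm} {σ : SType} : CLEqTyping Γ M σ → EqEta M N → CLEqTyping Γ N σ

/- ## LCL formulas and the axiomatic system -/

/-- Raw formulas of LCL: atomic type-assignment statements `M : σ`, negation, implication. -/
inductive LCLForm : Type
  | stm : CLTerm → SType → LCLForm
  | neg : LCLForm → LCLForm
  | imp : LCLForm → LCLForm → LCLForm

/-- A raw formula is a genuine LCL-formula when each atomic statement `M : σ`
occurring in it is derivable from some basis in CL→. -/
def LCLForm.WF : LCLForm → Prop
  | .stm M σ => ∃ Γ : Set (ℕ × SType), IsBasis Γ ∧ CLTyping Γ M σ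
  | .neg α => α.WF
  | .imp α β => α.WF ∧ β.WF

/-- The axiom schemes (Ax1)–(Ax8) of LCL. -/
inductive LCLAx : LCLForm → Prop
  | ax1 (σ τ ρ : SType) :
      LCLAx (.stm .S ((σ.arrow (τ.arrow ρ)).arrow ((σ.arrow τ).arrow (σ.arrow ρ))))
  | ax2 (σ τ : SType) : LCLAx (.stm .K (σ.arrow (τ.arrow σ)))
  | ax3 (σ : SType) : LCLAx (.stm .I (σ.arrow σ))
  | ax4 {M N : CLTerm} {σ τ : SType} :
      (LCLForm.stm M (σ.arrow τ)).WF → (LCLForm.stm N σ).WF → (LCLForm.stm (M.app N) τ).WF →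
      LCLAx ((LCLForm.stm M (σ.arrow τ)).imp ((LCLForm.stm N σ).imp (.stm (M.app N) τ)))
  | ax5 {M N : CLTerm} {σ : SType} :
      EqEta M N → (LCLForm.stm M σ).WF → (LCLForm.stm N σ).WF →
      LCLAx ((LCLForm.stm M σ).imp (.stm N σ))
  | ax6 {α β : LCLForm} : α.WF → β.WF → LCLAx (α.imp (β.imp α))
  | ax7 {α β γ : LCLForm} : α.WF → β.WF → γ.WF →
      LCLAx ((α.imp (β.imp γ)).imp ((α.imp β).imp (α.imp γ)))
  | ax8 {α β : LCLForm} : α.WF → β.WF →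
      LCLAx ((α.neg.imp β.neg).imp ((α.neg.imp β).imp α))

/-- Derivability `T ⊢ α` in LCL: axioms, hypotheses, and Modus Ponens. -/
inductive LCLDeriv (T : Set LCLForm) : LCLForm → Prop
  | ax {α : LCLForm} : LCLAx α → LCLDeriv T α
  | hyp {α : LCLForm} : α ∈ T → LCLDeriv T α
  | mp {α β : LCLForm} : LCLDeriv T (α.imp β) → LCLDeriv T α → LCLDeriv T β

/-- `T` is consistent if some LCL-formula is not derivable from `T`. -/
def LCLConsistent (T : Set LCLForm) : Prop :=
  ∃ α : LCLForm, α.WF ∧ ¬ LCLDeriv T α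

/-- `T` is maximal consistent if it is consistent and contains `α` or `¬α`
for every LCL-formula `α`. -/
def LCLMaxConsistent (T : Set LCLForm) : Prop :=
  LCLConsistent T ∧ ∀ α : LCLForm, α.WF → (α ∈ T ∨ α.neg ∈ T)

/-- The set of LCL-formulas corresponding to the declarations of a basis. -/
def basisForms (Γ : Set (ℕ × SType)) : Set LCLForm :=
  (fun p => LCLForm.stm (CLTerm.var p.1) p.2) '' Γ

/- ## Semantics -/

universe u

/-- An applicative structure for LCL. -/
structure AppStruct : Type (u + 1) where
  D : Type u
  nonempty : Nonempty D
  A : SType → Set D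
  app : D → D → D
  ext : ∀ d₁ d₂ : D, (∀ e : D, app d₁ e = app d₂ e) → d₁ = d₂
  app_mem : ∀ {σ τ : SType} {d e : D}, d ∈ A (σ.arrow τ) → e ∈ A σ → app d e ∈ A τ
  s : D
  k : D
  i : D
  s_mem : ∀ σ τ ρ : SType,
    s ∈ A ((σ.arrow (τ.arrow ρ)).arrow ((σ.arrow τ).arrow (σ.arrow ρ)))
  s_app : ∀ d e f : D, app (app (app s d) e) f = app (app d f) (app e f)
  k_mem : ∀ σ τ : SType, k ∈ A (σ.arrow (τ.arrow σ))
  k_app : ∀ d e : D, app (app k d) e = d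
  i_mem : ∀ σ : SType, i ∈ A (σ.arrow σ)
  i_app : ∀ d : D, app i d = d

/-- The interpretation `⟦M⟧_ρ` of a CL-term in an applicative structure
with environment `ρ`. -/
def interpTerm (𝒜 : AppStruct.{u}) (ρ : ℕ → 𝒜.D) : CLTerm → 𝒜.D
  | .var x => ρ x
  | .S => 𝒜.s
  | .K => 𝒜.k
  | .I => 𝒜.i
  | .app M N => 𝒜.app (interpTerm 𝒜 ρ M) (interpTerm 𝒜 ρ N)

/-- Satisfaction of an LCL-formula in an LCL-model `⟨𝒜, ρ⟩`. -/
def LCLSat (𝒜 : AppStruct.{u}) (ρ : ℕ → 𝒜.D) : LCLForm → Prop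
  | .stm M σ => interpTerm 𝒜 ρ M ∈ 𝒜.A σ
  | .neg α => ¬ LCLSat 𝒜 ρ α
  | .imp α β => LCLSat 𝒜 ρ α → LCLSat 𝒜 ρ β

/-- Semantical consequence `T ⊨ α`. -/
def LCLSemCons (T : Set LCLForm) (α : LCLForm) : Prop :=
  ∀ (𝒜 : AppStruct.{u}) (ρ : ℕ → 𝒜.D), (∀ β ∈ T, LCLSat 𝒜 ρ β) → LCLSat 𝒜 ρ α

/- ## The canonical (term) model -/

instance CLTerm.setoid : Setoid CLTerm :=
  ⟨EqEta, ⟨EqEta.refl, fun h => h.symm, fun h h' => h.trans h'⟩⟩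

/-- EQ^η-equivalence classes of CL-terms. -/
abbrev CLQuot : Type := Quotient CLTerm.setoid

theorem EqEta.app_congr {M N P Q : CLTerm} (h1 : EqEta M P) (h2 : EqEta N Q) :
    EqEta (M.app N) (P.app Q) := (EqEta.appL N h1).trans (EqEta.appR P h2)

/-- Application on equivalence classes: `[M]·[N] = [M N]`. -/
def canonApp : CLQuot → CLQuot → CLQuot :=
  Quotient.map₂ CLTerm.app (fun _ _ h1 _ _ h2 => EqEta.app_congr h1 h2)

/-- The canonical interpretation of a CL-term in the term model with
environment `ρ*(x) = [x]` : it satisfies `⟦M⟧_{ρ*} = [M]`. -/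
def canonInterp : CLTerm → CLQuot
  | .var x => ⟦.var x⟧
  | .S => ⟦.S⟧
  | .K => ⟦.K⟧
  | .I => ⟦.I⟧
  | .app M N => canonApp (canonInterp M) (canonInterp N)

/-- The canonical sets `A^σ = { [M] | M : σ ∈ T }` determined by a set of formulas. -/
def canonA (T : Set LCLForm) (σ : SType) : Set CLQuot :=
  {q | ∃ M : CLTerm, (⟦M⟧ : CLQuot) = q ∧ LCLForm.stm M σ ∈ T}

/-- The sets `A^σ = { [M] | Γ ⊢_{CL=} M : σ }` determined by a basis. -/
def canonAGamma (Γ : Set (ℕ × SType)) (σ : SType) : Set CLQuot :=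
  {q | ∃ M : CLTerm, (⟦M⟧ : CLQuot) = q ∧ CLEqTyping Γ M σ}

/-- Satisfaction in the canonical model `⟨M_{T}, ρ*⟩` with `ρ*(x) = [x]`. -/
def canonSat (T : Set LCLForm) : LCLForm → Prop
  | .stm M σ => canonInterp M ∈ canonA T σ
  | .neg α => ¬ canonSat T α
  | .imp α β => canonSat T α → canonSat T β

theorem CLTerm.finite_FV (M : CLTerm) : M.FV.Finite := by
  induction M with
  | var x => exact Set.finite_singleton x
  | S => exact Set.finite_empty
  | K => exact Set.finite_empty
  | I => exact Set.finite_empty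
  | app M N ihM ihN => exact ihM.union ihN

theorem EqEta.of_forall_app {M N : CLTerm} (h : ∀ P : CLTerm, EqEta (M.app P) (N.app P)) :
    EqEta M N :=
  have ⟨x, hx⟩ := (M.finite_FV.union N.finite_FV).exists_notMem
  EqEta.ext x (h (.var x)) hx

theorem mk_mem_canonAGamma {Γ : Set (ℕ × SType)} {M : CLTerm} {σ : SType} :
    (⟦M⟧ : CLQuot) ∈ canonAGamma Γ σ ↔ CLEqTyping Γ M σ :=
  ⟨fun ⟨_, hN, hσ⟩ => hσ.eq (Quotient.exact hN), fun h => ⟨M, rfl, h⟩⟩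

/-- The term model determined by a basis, lifted to an arbitrary universe. -/
def termStruct (Γ : Set (ℕ × SType)) : AppStruct.{u} where
  D := ULift.{u} CLQuot
  nonempty := ⟨⟨⟦.I⟧⟩⟩
  A σ := {d | d.down ∈ canonAGamma Γ σ}
  app d e := ⟨canonApp d.down e.down⟩
  ext := by
    rintro ⟨⟨M⟩⟩ ⟨⟨N⟩⟩ h
    exact congrArg ULift.up (Quotient.sound (EqEta.of_forall_app fun P =>
      Quotient.exact (congrArg ULift.down (h ⟨⟦P⟧⟩))))
  app_mem := by
    rintro σ τ ⟨_⟩ ⟨_⟩ ⟨M, rfl, hM⟩ ⟨N, rfl, hN⟩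
    exact ⟨M.app N, rfl, hM.app hN⟩
  s := ⟨⟦.S⟧⟩
  k := ⟨⟦.K⟧⟩
  i := ⟨⟦.I⟧⟩
  s_mem σ τ ρ := ⟨.S, rfl, .S σ τ ρ⟩
  s_app := by
    rintro ⟨⟨M⟩⟩ ⟨⟨N⟩⟩ ⟨⟨L⟩⟩
    exact congrArg ULift.up (Quotient.sound (EqEta.Sred M N L))
  k_mem σ τ := ⟨.K, rfl, .K σ τ⟩
  k_app := by
    rintro ⟨⟨M⟩⟩ ⟨⟨N⟩⟩
    exact congrArg ULift.up (Quotient.sound (EqEta.Kred M N))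
  i_mem σ := ⟨.I, rfl, .I σ⟩
  i_app := by
    rintro ⟨⟨M⟩⟩
    exact congrArg ULift.up (Quotient.sound (EqEta.Ired M))

theorem interpTerm_termStruct (Γ : Set (ℕ × SType)) (M : CLTerm) :
    interpTerm (termStruct.{u} Γ) (fun x => ⟨⟦.var x⟧⟩) M = ⟨⟦M⟧⟩ := by
  induction M with
  | var x => rfl
  | S => rfl
  | K => rfl
  | I => rfl
  | app M N ihM ihN => exact congrArg₂ (termStruct Γ).app ihM ihN

/-- Completeness of CL=→ w.r.t. the LCL-semantics. -/
theorem cl_eq_completeness (Γ : Set (ℕ × SType)) (hΓ : IsBasis Γ)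
    (M : CLTerm) (σ : SType)
    (h : LCLSemCons (basisForms Γ) (.stm M σ)) :
    CLEqTyping Γ M σ := by
  have hM : interpTerm (termStruct Γ) (fun x => ⟨⟦.var x⟧⟩) M ∈ (termStruct Γ).A σ :=
    h (termStruct Γ) _ (by
      rintro _ ⟨⟨x, τ⟩, hx, rfl⟩
      exact ⟨.var x, rfl, .var hx⟩)
  rw [interpTerm_termStruct] at hM
  exact mk_mem_canonAGamma.mp hM
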